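/- Let T be a finite tree and let A be an arrowflow on T with missing forest M(A). Suppose (i₁, j₁) and (i₂, j₂) are arcs of A such that i₁ and i₂ lie in the same connected component of M(A) and j₁ and j₂ lie in the same connected component of M(A). Then i₁ = i₂ and j₁ = j₂. -/

import Mathlib

open scoped Classical

/-- `H` is an `S`-rooted spanning forest of `G`: an acyclic spanning subgraph in which
distinct vertices of `S` lie in distinct connected components and every vertex is
reachable from some vertex of `S` (so there are exactly `|S|` components, each
containing exactly one vertex of `S`). -/
def IsSRootedForest {V : Type*} (G H : SimpleGraph V) (S : Finset V) : Prop :=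
  H ≤ G ∧ H.IsAcyclic ∧
    (∀ s ∈ S, ∀ t ∈ S, H.Reachable s t → s = t) ∧
    (∀ v : V, ∃ s ∈ S, H.Reachable s v)

/-- The set of vertices not reachable from `S` in `H`; for an `(S,*)`-rooted forest
this is the vertex set of the floating component. -/
def floatSet {V : Type*} (H : SimpleGraph V) (S : Finset V) : Set V :=
  {v | ∀ s ∈ S, ¬ H.Reachable s v}

/-- `H` is an `(S,*)`-rooted spanning forest of `G`: an acyclic spanning subgraph with
distinct vertices of `S` in distinct components, and whose vertices not reachable from
`S` form a single nonempty connected component (the floating component). -/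
def IsSStarRootedForest {V : Type*} (G H : SimpleGraph V) (S : Finset V) : Prop :=
  H ≤ G ∧ H.IsAcyclic ∧
    (∀ s ∈ S, ∀ t ∈ S, H.Reachable s t → s = t) ∧
    (floatSet H S).Nonempty ∧
    (∀ v ∈ floatSet H S, ∀ w ∈ floatSet H S, H.Reachable v w)

/-- The boundary degree of the floating component of `H`: the number of vertices not in
the floating component that are adjacent in `G` to some vertex of the floating
component. -/
noncomputable def bdeg {V : Type*} (G H : SimpleGraph V) (S : Finset V) : ℕ :=
  Set.ncard {v | v ∉ floatSet H S ∧ ∃ w ∈ floatSet H S, G.Adj v w}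

/-- An `m`-arrowflow on `G`: a multiset of `m` ordered pairs, each supported on an
edge of `G`. -/
def IsArrowflow {V : Type*} (G : SimpleGraph V) (m : ℕ) (A : Multiset (V × V)) : Prop :=
  Multiset.card A = m ∧ ∀ p ∈ A, G.Adj p.1 p.2

/-- The underlying simple graph of an arrowflow: `u ~ v` iff `(u,v)` or `(v,u)` is an
arc of `A`. -/
def arrowSG {V : Type*} (A : Multiset (V × V)) : SimpleGraph V :=
  SimpleGraph.fromRel (fun u v => (u, v) ∈ A)

/-- The missing forest of an arrowflow `A` on `G`: the spanning subgraph of `G` whose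
edges are the edges of `G` not underlying any arc of `A`. -/
def missingForest {V : Type*} (G : SimpleGraph V) (A : Multiset (V × V)) : SimpleGraph V :=
  G \ arrowSG A

/-- `A` has parallel arrows: some ordered pair occurs with multiplicity at least 2. -/
def HasParallelArrows {V : Type*} (A : Multiset (V × V)) : Prop :=
  ∃ p : V × V, 2 ≤ A.count p

/-- `A` has a missing path for `S`: two distinct vertices of `S` lie in the same
connected component of the missing forest. -/
def HasMissingPath {V : Type*} (G : SimpleGraph V) (S : Finset V) (A : Multiset (V × V)) : Prop :=
  ∃ i ∈ S, ∃ j ∈ S, i ≠ j ∧ (missingForest G A).Reachable i j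

/-- `A` is zero-sum for `S`. -/
def IsZeroSum {V : Type*} (G : SimpleGraph V) (S : Finset V) (A : Multiset (V × V)) : Prop :=
  HasParallelArrows A ∨ HasMissingPath G S A

/-- `A` is unital for `S`: no parallel arrows, and the missing forest is `S`-rooted. -/
def IsUnital {V : Type*} (G : SimpleGraph V) (S : Finset V) (A : Multiset (V × V)) : Prop :=
  ¬ HasParallelArrows A ∧ IsSRootedForest G (missingForest G A) S

/-- `A` is composite for `S`: no parallel arrows, and the missing forest is
`(S,*)`-rooted. -/
def IsComposite {V : Type*} (G : SimpleGraph V) (S : Finset V) (A : Multiset (V × V)) : Prop :=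
  ¬ HasParallelArrows A ∧ IsSStarRootedForest G (missingForest G A) S

/-- The missing forest contains no edge that underlies an arc. -/
lemma missingForest_le_deleteEdges {V : Type*} (G : SimpleGraph V) {A : Multiset (V × V)}
    {i j : V} (h : (i, j) ∈ A) : missingForest G A ≤ G.deleteEdges {s(i, j)} := by
  intro u v huv
  obtain ⟨hG, hA⟩ := (SimpleGraph.sdiff_adj _ _ _ _).mp huv
  rw [SimpleGraph.deleteEdges_adj, Set.mem_singleton_iff, Sym2.eq_iff]
  refine ⟨hG, ?_⟩
  rintro (⟨rfl, rfl⟩ | ⟨rfl, rfl⟩)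
  · exact hA ((SimpleGraph.fromRel_adj _ _ _).mpr ⟨hG.ne, .inl h⟩)
  · exact hA ((SimpleGraph.fromRel_adj _ _ _).mpr ⟨hG.ne, .inr h⟩)

theorem arc_determined_by_components
    {V : Type*} [Fintype V] (G : SimpleGraph V) (hG : G.IsTree)
    (A : Multiset (V × V)) (hA : ∀ p ∈ A, G.Adj p.1 p.2)
    (i₁ j₁ i₂ j₂ : V) (h₁ : (i₁, j₁) ∈ A) (h₂ : (i₂, j₂) ∈ A)
    (hi : (missingForest G A).Reachable i₁ i₂)
    (hj : (missingForest G A).Reachable j₁ j₂) :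
    i₁ = i₂ ∧ j₁ = j₂ := by
  have hle := missingForest_le_deleteEdges G h₁
  have hbridge : ¬ (G.deleteEdges {s(i₁, j₁)}).Reachable i₁ j₁ :=
    SimpleGraph.isBridge_iff.mp <| SimpleGraph.isAcyclic_iff_forall_isBridge.mp hG.isAcyclic
      (G.mem_edgeSet.mpr (hA _ h₁))
  by_cases he : s(i₂, j₂) = s(i₁, j₁)
  · rcases Sym2.eq_iff.mp he with ⟨rfl, rfl⟩ | ⟨rfl, rfl⟩
    · exact ⟨rfl, rfl⟩
    · exact absurd (hi.mono hle) hbridge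
  · have hadj : (G.deleteEdges {s(i₁, j₁)}).Adj i₂ j₂ :=
      SimpleGraph.deleteEdges_adj.mpr ⟨hA _ h₂, he⟩
    exact absurd (((hi.mono hle).trans hadj.reachable).trans (hj.mono hle).symm) hbridge
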